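/- arXiv:math/0604175 — 4 statements merged into one kernel-verified Lean document; each statement's English description precedes it below -/
import Mathlib

section
/- Suppose f_c has a Siegel disk Δ of period m ≥ 1, and let z ∈ ℂ be such that f_c^[k](z) ∈ Δ for some k ∈ ℕ. Then (z,c) ∈ 𝕁; equivalently, for every δ > 0 there exist z̃, c̃ ∈ ℂ with |z − z̃| < δ, |c − c̃| < δ and z̃ ∈ J_{c̃}. -/
open Filter Metric Topology

noncomputable section

/-- The quadratic polynomial `f_c(z) = z² + c`. -/
def f (c : ℂ) : ℂ → ℂ := fun z => z ^ 2 + c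

/-- The filled Julia set `K_c`: points with bounded forward orbit. -/
def K (c : ℂ) : Set ℂ := {z : ℂ | Bornology.IsBounded (Set.range fun n => (f c)^[n] z)}

/-- The Julia set `J_c`: the boundary of the filled Julia set. -/
def J (c : ℂ) : Set ℂ := frontier (K c)

/-- The set `𝕁`: the closure in `ℂ × ℂ` of `{(z,c) : z ∈ J_c}`. -/
def bbJ : Set (ℂ × ℂ) := closure {p : ℂ × ℂ | p.1 ∈ J p.2}

/-- `Δ` is a Siegel disk of `f_c` of period `m ≥ 1` with center `ζ`. -/
def IsSiegelDisk (c : ℂ) (m : ℕ) (Δ : Set ℂ) (ζ : ℂ) : Prop :=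
  1 ≤ m ∧ IsOpen Δ ∧ IsConnected Δ ∧ ζ ∈ Δ ∧ (f c)^[m] '' Δ = Δ ∧ (f c)^[m] ζ = ζ ∧
    ∃ α : ℝ, Irrational α ∧ ∃ φ : ℂ → ℂ,
      DifferentiableOn ℂ φ Δ ∧ Set.BijOn φ Δ (Metric.ball (0 : ℂ) 1) ∧ φ ζ = 0 ∧
      ∀ w ∈ Δ, φ ((f c)^[m] w) = Complex.exp (2 * Real.pi * Complex.I * α) * φ w

lemma contDiff_iterate (n : ℕ) : ContDiff ℂ 1 fun p : ℂ × ℂ => (f p.2)^[n] p.1 := by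
  induction n with
  | zero => exact contDiff_fst
  | succ n ih =>
    simp only [Function.iterate_succ_apply']
    exact (ih.pow 2).add contDiff_snd

lemma continuous_iterate_prod (n : ℕ) : Continuous fun p : ℂ × ℂ => (f p.2)^[n] p.1 :=
  (contDiff_iterate n).continuous

lemma differentiable_iterate (c : ℂ) (n : ℕ) : Differentiable ℂ (f c)^[n] := by
  have h := (contDiff_iterate n).differentiable one_ne_zero
  exact h.comp (differentiable_id.prodMk (differentiable_const c))

lemma continuous_iterate (c : ℂ) (n : ℕ) : Continuous (f c)^[n] :=
  (differentiable_iterate c n).continuous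

lemma mem_K_of_forall_norm_le {c z : ℂ} {R : ℝ} (h : ∀ n, ‖(f c)^[n] z‖ ≤ R) : z ∈ K c := by
  refine (isBounded_iff_forall_norm_le (s := Set.range fun n => (f c)^[n] z)).2 ⟨R, ?_⟩
  rintro _ ⟨n, rfl⟩
  exact h n

lemma apply_mem_K_iff {c z : ℂ} : f c z ∈ K c ↔ z ∈ K c := by
  have key : (Set.range fun n => (f c)^[n] z) =
      insert z (Set.range fun n => (f c)^[n] (f c z)) := by
    ext w
    constructor
    · rintro ⟨_ | n, rfl⟩
      · exact Or.inl rfl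
      · exact Or.inr ⟨n, rfl⟩
    · rintro (rfl | ⟨n, rfl⟩)
      · exact ⟨0, rfl⟩
      · exact ⟨n + 1, rfl⟩
  simp only [K, Set.mem_ofPred_eq, key, Bornology.isBounded_insert]

lemma iterate_mem_K_iff {c z : ℂ} (n : ℕ) : (f c)^[n] z ∈ K c ↔ z ∈ K c := by
  induction n with
  | zero => rfl
  | succ n ih => rw [Function.iterate_succ_apply', apply_mem_K_iff, ih]

lemma two_mul_norm_le_norm_apply {c z : ℂ} (h : 2 + ‖c‖ ≤ ‖z‖) : 2 * ‖z‖ ≤ ‖f c z‖ := by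
  have h1 : ‖z‖ ^ 2 - ‖c‖ ≤ ‖f c z‖ := by
    have := norm_sub_norm_le (z ^ 2) (-c)
    simpa [f, norm_pow] using this
  nlinarith [norm_nonneg c, norm_nonneg z]

lemma two_pow_mul_norm_le_norm_iterate {c z : ℂ} (h : 2 + ‖c‖ ≤ ‖z‖) (n : ℕ) :
    2 ^ n * ‖z‖ ≤ ‖(f c)^[n] z‖ := by
  induction n with
  | zero => simp
  | succ n ih =>
    rw [Function.iterate_succ_apply']
    have h2 : ‖z‖ ≤ 2 ^ n * ‖z‖ :=
      le_mul_of_one_le_left (norm_nonneg z) (one_le_pow₀ one_le_two)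
    have := two_mul_norm_le_norm_apply (h.trans (h2.trans ih))
    rw [pow_succ]
    linarith

lemma norm_le_of_mem_K {c z : ℂ} (h : z ∈ K c) : ‖z‖ ≤ 2 + ‖c‖ := by
  by_contra! hz
  obtain ⟨R, hR⟩ := (isBounded_iff_forall_norm_le (s := Set.range fun n => (f c)^[n] z)).1 h
  have hz0 : 1 ≤ ‖z‖ := by linarith [norm_nonneg c]
  obtain ⟨n, hn⟩ := pow_unbounded_of_one_lt R one_lt_two
  have h1 := two_pow_mul_norm_le_norm_iterate hz.le n
  have h2 := hR _ ⟨n, rfl⟩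
  have h3 : (2 : ℝ) ^ n ≤ 2 ^ n * ‖z‖ := le_mul_of_one_le_right (by positivity) hz0
  linarith

lemma norm_iterate_le_of_mem_K {c z : ℂ} (h : z ∈ K c) (n : ℕ) : ‖(f c)^[n] z‖ ≤ 2 + ‖c‖ :=
  norm_le_of_mem_K ((iterate_mem_K_iff n).2 h)

lemma isClosed_K (c : ℂ) : IsClosed (K c) := by
  have : K c = ⋂ n, (f c)^[n] ⁻¹' closedBall 0 (2 + ‖c‖) := by
    ext z
    simp only [Set.mem_iInter, Set.mem_preimage, mem_closedBall_zero_iff]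
    exact ⟨norm_iterate_le_of_mem_K, mem_K_of_forall_norm_le⟩
  rw [this]
  exact isClosed_iInter fun n => isClosed_closedBall.preimage (continuous_iterate c n)

/-- A square root close to a given one. -/
lemma exists_sq_eq_norm_sub_lt {w z : ℂ} {ε : ℝ} (hε : 0 < ε) (h : ‖w - z ^ 2‖ < ε ^ 2) :
    ∃ x : ℂ, x ^ 2 = w ∧ ‖x - z‖ < ε := by
  obtain ⟨x, hx⟩ := IsAlgClosed.exists_pow_nat_eq w two_pos
  have h1 : ‖x - z‖ * ‖x + z‖ < ε ^ 2 := by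
    rw [← norm_mul]
    convert h using 2
    rw [← hx]; ring
  by_cases h2 : ‖x - z‖ < ε
  · exact ⟨x, hx, h2⟩
  · refine ⟨-x, by rw [neg_sq, hx], ?_⟩
    rw [show -x - z = -(x + z) by ring, norm_neg]
    by_contra! h3
    nlinarith

lemma isOpenMap_f (c : ℂ) : IsOpenMap (f c) := by
  refine IsOpenMap.of_nhds_le fun z => ?_
  intro s hs
  obtain ⟨ε, hε, hs⟩ := Metric.mem_nhds_iff.1 (mem_map.1 hs)
  refine Metric.mem_nhds_iff.2 ⟨ε ^ 2, by positivity, fun w hw => ?_⟩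
  obtain ⟨x, hx, hxz⟩ := exists_sq_eq_norm_sub_lt (w := w - c) (z := z) hε (by
    rw [mem_ball, dist_eq_norm] at hw
    have : w - c - z ^ 2 = w - f c z := by simp only [f]; ring
    rwa [this])
  have : f c x ∈ s := hs (by rwa [mem_ball, dist_eq_norm])
  rwa [f, hx, sub_add_cancel] at this

lemma continuous_f (c : ℂ) : Continuous (f c) := by unfold f; fun_prop

lemma apply_mem_J_iff {c z : ℂ} : f c z ∈ J c ↔ z ∈ J c := by
  have h := (isOpenMap_f c).preimage_frontier_eq_frontier_preimage (continuous_f c) (K c)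
  have h2 : f c ⁻¹' K c = K c := by ext z; exact apply_mem_K_iff
  rw [h2] at h
  exact Set.ext_iff.1 h z

lemma iterate_mem_J_iff {c z : ℂ} (n : ℕ) : (f c)^[n] z ∈ J c ↔ z ∈ J c := by
  induction n with
  | zero => rfl
  | succ n ih => rw [Function.iterate_succ_apply', apply_mem_J_iff, ih]

lemma mem_bbJ_of_apply_mem {c z : ℂ} (h : (f c z, c) ∈ bbJ) : (z, c) ∈ bbJ := by
  rw [bbJ, Metric.mem_closure_iff] at h ⊢
  intro ε hε
  obtain ⟨⟨y, c'⟩, hy, hd⟩ := h (min ε (ε ^ 2 / 2)) (by positivity)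
  rw [Prod.dist_eq, max_lt_iff, lt_min_iff, lt_min_iff] at hd
  simp only [dist_eq_norm, Set.mem_ofPred_eq] at hd hy
  obtain ⟨x, hx, hxz⟩ := exists_sq_eq_norm_sub_lt (w := y - c') (z := z) hε (by
    have : y - c' - z ^ 2 = (c - c') - (f c z - y) := by simp only [f]; ring
    rw [this]
    linarith [norm_sub_le (c - c') (f c z - y), hd.1.2, hd.2.2])
  refine ⟨(x, c'), ?_, ?_⟩
  · show x ∈ J c'
    rw [← apply_mem_J_iff, f, hx, sub_add_cancel]
    exact hy
  · rw [Prod.dist_eq, max_lt_iff, dist_comm, dist_eq_norm, dist_eq_norm]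
    exact ⟨hxz, hd.2.1⟩

lemma mem_bbJ_of_iterate_mem {c z : ℂ} (n : ℕ) (h : ((f c)^[n] z, c) ∈ bbJ) : (z, c) ∈ bbJ := by
  induction n with
  | zero => exact h
  | succ n ih =>
    rw [Function.iterate_succ_apply'] at h
    exact ih (mem_bbJ_of_apply_mem h)

lemma norm_deriv_iterate_le_one_of_mem_interior {c ζ : ℂ} {m : ℕ} (hζ : (f c)^[m] ζ = ζ)
    (hi : ζ ∈ interior (K c)) : ‖deriv (f c)^[m] ζ‖ ≤ 1 := by
  obtain ⟨r, hr, hrK⟩ := Metric.nhds_basis_closedBall.mem_iff.1 (mem_interior_iff_mem_nhds.1 hi)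
  by_contra! h
  obtain ⟨n, hn⟩ := pow_unbounded_of_one_lt ((2 + ‖c‖) / r) h
  have hd : HasDerivAt ((f c)^[m])^[n] ((deriv (f c)^[m] ζ) ^ n) ζ :=
    HasDerivAt.iterate _ (differentiable_iterate c m ζ).hasDerivAt hζ n
  rw [← Function.iterate_mul] at hd
  have := Complex.norm_deriv_le_of_forall_mem_sphere_norm_le (C := 2 + ‖c‖) hr
    (differentiable_iterate c (m * n)).diffContOnCl
    fun z hz => norm_iterate_le_of_mem_K (hrK (sphere_subset_closedBall hz)) _
  rw [hd.deriv, norm_pow] at this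
  linarith

lemma mem_K_of_iterate_eq {c ζ : ℂ} {m : ℕ} (hm : m ≠ 0) (hζ : (f c)^[m] ζ = ζ) : ζ ∈ K c := by
  have hp : Function.IsPeriodicPt (f c) m ζ := hζ
  refine (((Set.finite_lt_nat m).image fun n => (f c)^[n] ζ).subset ?_).isBounded
  rintro _ ⟨n, rfl⟩
  exact ⟨n % m, Nat.mod_lt _ (Nat.pos_of_ne_zero hm), hp.iterate_mod_apply n⟩

lemma mem_J_of_one_lt_norm_deriv {c β : ℂ} {q : ℕ} (hq : q ≠ 0) (hβ : (f c)^[q] β = β)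
    (h : 1 < ‖deriv (f c)^[q] β‖) : β ∈ J c := by
  rw [J, (isClosed_K c).frontier_eq]
  exact ⟨mem_K_of_iterate_eq hq hβ, fun hi =>
    h.not_ge (norm_deriv_iterate_le_one_of_mem_interior hβ hi)⟩

lemma contDiff_deriv_iterate (m : ℕ) :
    ContDiff ℂ 1 fun p : ℂ × ℂ => deriv (f p.2)^[m] p.1 := by
  induction m with
  | zero =>
    simp only [Function.iterate_zero, deriv_id]
    exact contDiff_const
  | succ m ih =>
    have : (fun p : ℂ × ℂ => deriv (f p.2)^[m + 1] p.1) =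
        fun p => 2 * (f p.2)^[m] p.1 * deriv (f p.2)^[m] p.1 := by
      ext p
      have h : HasDerivAt (f p.2)^[m] (deriv (f p.2)^[m] p.1) p.1 :=
        (differentiable_iterate p.2 m p.1).hasDerivAt
      have h2 := (h.pow 2).add_const p.2
      rw [Function.iterate_succ']
      simpa [f, Function.comp_def] using h2.deriv
    rw [this]
    exact (contDiff_const.mul (contDiff_iterate m)).mul ih

/-- A periodic point whose multiplier is not `1` persists under perturbation of the parameter. -/
lemma exists_periodic_continuation {c ζ : ℂ} {m : ℕ} (hζ : (f c)^[m] ζ = ζ)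
    (h1 : deriv (f c)^[m] ζ ≠ 1) :
    ∃ Z : ℂ → ℂ, Z c = ζ ∧ (∀ᶠ c' in 𝓝 c, DifferentiableAt ℂ Z c') ∧
      ∀ᶠ c' in 𝓝 c, (f c')^[m] (Z c') = Z c' := by
  set G : ℂ × ℂ → ℂ := fun p => (f p.1)^[m] p.2 - p.2 with hG
  have hGd : ContDiff ℂ 1 G :=
    ((contDiff_iterate m).comp (contDiff_snd.prodMk contDiff_fst)).sub contDiff_snd
  have hGc : ContDiffAt ℂ 1 G (c, ζ) := hGd.contDiffAt
  have hv : (fderiv ℂ G (c, ζ)) (0, 1) = deriv (f c)^[m] ζ - 1 := by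
    have h := (hGd.differentiable one_ne_zero (c, ζ)).hasFDerivAt
    have h2 : HasDerivAt (fun w : ℂ => (c, w)) ((0 : ℂ), (1 : ℂ)) ζ :=
      (hasDerivAt_const ζ c).prodMk (hasDerivAt_id ζ)
    have h3 := h.comp_hasDerivAt ζ h2
    have h4 : HasDerivAt (fun w => (f c)^[m] w - w) (deriv (f c)^[m] ζ - 1) ζ :=
      (differentiable_iterate c m ζ).hasDerivAt.sub (hasDerivAt_id ζ)
    exact h3.unique h4
  have hinv : (fderiv ℂ G (c, ζ) ∘L .inr ℂ ℂ ℂ).IsInvertible := by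
    refine ⟨ContinuousLinearEquiv.unitsEquivAut ℂ (Units.mk0 _ (sub_ne_zero.2 h1)), ?_⟩
    ext
    simp [hv]
  refine ⟨hGc.implicitFunction one_ne_zero hinv, hGc.implicitFunction_apply_self _ _, ?_, ?_⟩
  · have := (hGc.contDiffAt_implicitFunction one_ne_zero hinv).eventually (by simp)
    exact this.mono fun x hx => hx.differentiableAt one_ne_zero
  · filter_upwards [hGc.eventually_apply_implicitFunction one_ne_zero hinv] with x hx
    have : G (c, ζ) = 0 := by simp [hG, hζ]
    rw [this] at hx
    exact sub_eq_zero.1 hx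

/-- Every quadratic polynomial has a repelling periodic point. -/
lemma exists_repelling (c : ℂ) :
    ∃ (q : ℕ) (β : ℂ), q ≠ 0 ∧ (f c)^[q] β = β ∧ 1 < ‖deriv (f c)^[q] β‖ := by
  by_cases hc : c = 1 / 4
  · refine ⟨2, (-1 + 2 * Complex.I) / 2, two_ne_zero, ?_, ?_⟩
    · subst hc
      simp only [f, Function.iterate_succ, Function.iterate_zero, Function.comp_apply, id]
      linear_combination (Complex.I ^ 2 - 2 * Complex.I + 1) * (Complex.I_sq)
    · have hd : HasDerivAt (f c)^[2] (2 * (((-1 + 2 * Complex.I) / 2) ^ 2 + c) *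
          (2 * ((-1 + 2 * Complex.I) / 2))) ((-1 + 2 * Complex.I) / 2) := by
        have h := ((((hasDerivAt_id ((-1 + 2 * Complex.I) / 2)).pow 2).add_const c).pow 2).add_const
          c
        simpa [f, Function.comp_def] using h
      rw [hd.deriv]
      have : 2 * (((-1 + 2 * Complex.I) / 2) ^ 2 + c) * (2 * ((-1 + 2 * Complex.I) / 2)) = 5 := by
        subst hc
        linear_combination (4 * Complex.I - 6) * (Complex.I_sq)
      rw [this]
      norm_num
  · obtain ⟨s, hs, hre⟩ : ∃ s : ℂ, s ^ 2 = 1 - 4 * c ∧ 0 ≤ s.re := by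
      obtain ⟨s, hs⟩ := IsAlgClosed.exists_pow_nat_eq (1 - 4 * c) two_pos
      rcases le_total 0 s.re with h | h
      · exact ⟨s, hs, h⟩
      · exact ⟨-s, by rw [neg_sq, hs], by simpa using h⟩
    have hs0 : s ≠ 0 := by
      rintro rfl
      exact hc (by linear_combination (1 / 4) * hs)
    refine ⟨1, (1 + s) / 2, one_ne_zero, ?_, ?_⟩
    · simp only [f, Function.iterate_one]
      linear_combination (1 / 4) * hs
    · have hd : HasDerivAt (f c)^[1] (1 + s) ((1 + s) / 2) := by
        have h : HasDerivAt (f c)^[1] _ ((1 + s) / 2) :=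
          ((hasDerivAt_id ((1 + s) / 2)).pow 2).add_const c
        exact h.congr_deriv (by simp; ring)
      rw [hd.deriv]
      have h2 : 1 < Complex.normSq (1 + s) := by
        have := Complex.normSq_pos.2 hs0
        rw [Complex.normSq_apply] at this ⊢
        simp only [Complex.add_re, Complex.one_re, Complex.add_im, Complex.one_im]
        nlinarith
      rw [Complex.normSq_eq_norm_sq] at h2
      nlinarith [norm_nonneg (1 + s)]

open Polynomial in
/-- The `n`-th iterate of `z ↦ z² + c`, as a polynomial in `z` over the polynomials in `c`. -/
def iteratePoly : ℕ → ℂ[X][X]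
  | 0 => X
  | n + 1 => iteratePoly n ^ 2 + C X

section

open Polynomial

lemma eval_map_iteratePoly (c z : ℂ) (n : ℕ) :
    ((iteratePoly n).map (evalRingHom c)).eval z = (f c)^[n] z := by
  induction n with
  | zero => simp [iteratePoly]
  | succ n ih =>
    rw [Function.iterate_succ_apply', ← ih]
    simp [iteratePoly, f]

lemma eval_map_derivative_iteratePoly (c z : ℂ) (n : ℕ) :
    ((derivative (iteratePoly n)).map (evalRingHom c)).eval z = deriv (f c)^[n] z := by
  rw [← derivative_map, ← Polynomial.deriv]
  congr 1
  ext w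
  exact eval_map_iteratePoly c w n

lemma natDegree_iteratePoly (n : ℕ) : (iteratePoly n).natDegree = 2 ^ n := by
  induction n with
  | zero => simp [iteratePoly]
  | succ n ih => rw [iteratePoly, natDegree_add_C, natDegree_pow, ih, pow_succ, mul_comm]

lemma iterate_zero_param (n : ℕ) (z : ℂ) : (f 0)^[n] z = z ^ 2 ^ n := by
  induction n with
  | zero => simp
  | succ n ih => rw [Function.iterate_succ_apply', ih, f, add_zero, ← pow_mul, pow_succ]

/-- For only finitely many parameters is there a cycle with given multiplier of modulus one. -/
lemma finite_setOf_exists_multiplier_eq {m : ℕ} (hm : m ≠ 0) {μ : ℂ} (hμ : ‖μ‖ = 1) :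
    {c : ℂ | ∃ z, (f c)^[m] z = z ∧ deriv (f c)^[m] z = μ}.Finite := by
  set N := 2 ^ m with hN
  have hN2 : 2 ≤ N := by
    calc 2 = 2 ^ 1 := rfl
      _ ≤ 2 ^ m := Nat.pow_le_pow_right two_pos (Nat.one_le_iff_ne_zero.2 hm)
  set A : ℂ[X][X] := iteratePoly m - X with hA
  set B : ℂ[X][X] := derivative (iteratePoly m) - C (C μ) with hB
  have hAd : A.natDegree ≤ N := by
    refine (natDegree_sub_le _ _).trans ?_
    rw [natDegree_iteratePoly, natDegree_X]
    omega
  have hBd : B.natDegree ≤ N - 1 := by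
    rw [hB, natDegree_sub_C]
    refine (natDegree_derivative_le _).trans ?_
    rw [natDegree_iteratePoly]
  have evalA (c z : ℂ) : (A.map (evalRingHom c)).eval z = (f c)^[m] z - z := by
    simp [hA, eval_map_iteratePoly]
  have evalB (c z : ℂ) : (B.map (evalRingHom c)).eval z = deriv (f c)^[m] z - μ := by
    simp [hB, eval_map_derivative_iteratePoly]
  set R := resultant A B N (N - 1) with hR
  obtain ⟨p, q, -, -, hpq⟩ := exists_mul_add_mul_eq_C_resultant A B hAd hBd (by omega)
  have hsub : {c : ℂ | ∃ z, (f c)^[m] z = z ∧ deriv (f c)^[m] z = μ} ⊆ {c | R.IsRoot c} := by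
    rintro c ⟨z, h1, h2⟩
    have := congrArg (fun P => (Polynomial.map (evalRingHom c) P).eval z) hpq
    simp only [Polynomial.map_add, Polynomial.map_mul, eval_add, eval_mul, evalA, evalB, h1, h2,
      sub_self, zero_mul, add_zero, Polynomial.map_C, eval_C] at this
    exact this.symm
  refine (R.finite_setOfPred_isRoot ?_).subset hsub
  intro hR0
  have h0 : resultant (A.map (evalRingHom 0)) (B.map (evalRingHom 0)) N (N - 1) = 0 := by
    rw [resultant_map_map, ← hR, hR0, map_zero]
  have hP0 : (iteratePoly m).map (evalRingHom 0) = X ^ N := by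
    refine Polynomial.funext fun z => ?_
    rw [eval_map_iteratePoly, iterate_zero_param, eval_pow, eval_X]
  have hA0 : A.map (evalRingHom 0) = X ^ N - X := by
    rw [hA, Polynomial.map_sub, hP0, map_X]
  have hB0 : B.map (evalRingHom 0) = C (N : ℂ) * X ^ (N - 1) - C μ := by
    rw [hB, Polynomial.map_sub, ← derivative_map, hP0, derivative_X_pow]
    simp
  have hdA : (A.map (evalRingHom 0)).natDegree = N := by
    rw [hA0, natDegree_sub_eq_left_of_natDegree_lt] <;> simp
    omega
  have hNC : (N : ℂ) ≠ 0 := by norm_cast; omega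
  have hdB : (B.map (evalRingHom 0)).natDegree = N - 1 := by
    rw [hB0, natDegree_sub_C, natDegree_C_mul_X_pow _ _ hNC]
  refine resultant_ne_zero (A.map (evalRingHom 0)) (B.map (evalRingHom 0)) ?_ (by
    rw [hdA, hdB]; exact h0)
  rw [isCoprime_iff_aeval_ne_zero_of_isAlgClosed ℂ ℂ]
  intro z
  by_contra! h
  rw [hA0, hB0] at h
  simp only [map_sub, map_pow, aeval_X, map_mul, aeval_C, Algebra.algebraMap_self,
    RingHom.id_apply] at h
  obtain ⟨h1, h2⟩ := h
  have hμ0 : μ ≠ 0 := by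
    rintro rfl
    simp at hμ
  have hz1 : z ^ N = z ^ (N - 1) * z := by
    rw [← pow_succ]; congr 1; omega
  have h3 : ((N : ℂ) - μ) * z = 0 := by
    rw [hz1] at h1
    linear_combination z * h2 - (N : ℂ) * h1
  rcases mul_eq_zero.1 h3 with h3 | h3
  · rw [← sub_eq_zero.1 h3, Complex.norm_natCast] at hμ
    norm_cast at hμ
    omega
  · rw [h3, zero_pow (by omega)] at h2
    simp at h2
    exact hμ0 h2

end

/-- The multiplier of the center of a Siegel disk has modulus one and is not equal to one. -/
lemma IsSiegelDisk.norm_multiplier {c : ℂ} {m : ℕ} {Δ : Set ℂ} {ζ : ℂ}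
    (h : IsSiegelDisk c m Δ ζ) :
    ‖deriv (f c)^[m] ζ‖ = 1 ∧ deriv (f c)^[m] ζ ≠ 1 := by
  obtain ⟨-, hO, -, hζ, -, hfix, α, hα, φ, hφ, hbij, hφ0, hrot⟩ := h
  set F := (f c)^[m] with hF
  set lam := deriv F ζ with hlam
  set e := Complex.exp (2 * Real.pi * Complex.I * α) with he
  have hnorm : ‖e‖ = 1 := by
    rw [he, show (2 * Real.pi * Complex.I * α : ℂ) = ((2 * Real.pi * α : ℝ) : ℂ) * Complex.I by
      push_cast; ring]
    exact Complex.norm_exp_ofReal_mul_I _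
  have he1 : e ≠ 1 := by
    intro h1
    obtain ⟨n, hn⟩ := Complex.exp_eq_one_iff.1 h1
    have h2 : (α : ℂ) = n := by
      have : (2 * Real.pi * Complex.I : ℂ) ≠ 0 := Complex.two_pi_I_ne_zero
      apply mul_left_cancel₀ this
      rw [hn]; ring
    exact hα.ne_int n (by exact_mod_cast h2)
  have hnhds : Δ ∈ 𝓝 ζ := hO.mem_nhds hζ
  have han : AnalyticAt ℂ φ ζ := hφ.analyticAt hnhds
  have hne : ¬ ∀ᶠ z in 𝓝 ζ, φ z = 0 := by
    intro h0
    have h1 : ∀ᶠ z in 𝓝[≠] ζ, φ z = 0 ∧ z ∈ Δ ∧ z ≠ ζ :=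
      (h0.filter_mono nhdsWithin_le_nhds).and
        ((eventually_mem_set.2 (mem_nhdsWithin_of_mem_nhds hnhds)).and self_mem_nhdsWithin)
    obtain ⟨z, h2, h3, h4⟩ := h1.exists
    exact h4 (hbij.injOn h3 hζ (h2.trans hφ0.symm))
  obtain ⟨p, g, hg, hg0, hev⟩ := (han.exists_eventuallyEq_pow_smul_nonzero_iff).2 hne
  have hFd : HasDerivAt F lam ζ := (differentiable_iterate c m ζ).hasDerivAt
  have hFt : Tendsto F (𝓝 ζ) (𝓝 ζ) := by
    have := (differentiable_iterate c m).continuous.tendsto ζ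
    rwa [← hF, hfix] at this
  have hslope : Tendsto (slope F ζ) (𝓝[≠] ζ) (𝓝 lam) := hasDerivAt_iff_tendsto_slope.1 hFd
  have hlim1 : Tendsto (fun w => slope F ζ w ^ p * g (F w)) (𝓝[≠] ζ) (𝓝 (lam ^ p * g ζ)) :=
    (hslope.pow p).mul ((hg.continuousAt.tendsto.comp hFt).mono_left nhdsWithin_le_nhds)
  have hlim2 : Tendsto (fun w => e * g w) (𝓝[≠] ζ) (𝓝 (e * g ζ)) :=
    (hg.continuousAt.tendsto.const_mul e).mono_left nhdsWithin_le_nhds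
  have heq : (fun w => slope F ζ w ^ p * g (F w)) =ᶠ[𝓝[≠] ζ] fun w => e * g w := by
    filter_upwards [hev.filter_mono nhdsWithin_le_nhds,
      (hFt.eventually hev).filter_mono nhdsWithin_le_nhds,
      mem_nhdsWithin_of_mem_nhds hnhds, self_mem_nhdsWithin] with w h1 h2 h3 h4
    have hw : (w - ζ) ^ p ≠ 0 := pow_ne_zero _ (sub_ne_zero.2 h4)
    have h5 := hrot w h3
    rw [h1, h2, smul_eq_mul, smul_eq_mul] at h5
    rw [slope_def_field, hfix, div_pow]
    field_simp
    linear_combination h5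
  have hpow : lam ^ p = e :=
    mul_right_cancel₀ hg0 (tendsto_nhds_unique (hlim1.congr' heq) hlim2)
  have hp : p ≠ 0 := by
    rintro rfl
    exact he1 (by rw [← hpow, pow_zero])
  constructor
  · have : ‖lam‖ ^ p = 1 := by rw [← norm_pow, hpow, hnorm]
    exact (pow_eq_one_iff_of_nonneg (norm_nonneg _) hp).1 this
  · intro h1
    rw [h1, one_pow] at hpow
    exact he1 hpow.symm

/-- Density of the orbits of an irrational rotation, on the unit circle. -/
lemma exists_norm_exp_pow_mul_sub_lt {α : ℝ} (hα : Irrational α) {u v : ℂ} (huv : ‖u‖ = ‖v‖)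
    {ε : ℝ} (hε : 0 < ε) :
    ∃ n : ℕ, ‖Complex.exp (2 * Real.pi * Complex.I * α) ^ n * u - v‖ < ε := by
  rcases eq_or_ne u 0 with rfl | hu
  · have : v = 0 := by simpa using huv.symm
    exact ⟨0, by simpa [this] using hε⟩
  have hd : DenseRange fun n : ℕ => n • (α : AddCircle (1 : ℝ)) := by
    rw [← denseRange_zsmul_iff_nsmul]
    exact AddCircle.denseRange_zsmul_coe_iff.2 (by simpa using hα)
  obtain ⟨θ, hθ⟩ : ∃ θ : ℝ, Complex.exp (θ * Complex.I) = v / u := by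
    rw [← Complex.norm_eq_one_iff, norm_div, huv, div_self]
    rw [← huv]
    exact norm_ne_zero_iff.2 hu
  set T : AddCircle (1 : ℝ) → ℂ := fun x => (AddCircle.toCircle x : ℂ) * u with hT
  have hTc : Continuous T := by
    exact (continuous_subtype_val.comp AddCircle.continuous_toCircle).mul continuous_const
  have hTv : T ((θ / (2 * Real.pi) : ℝ) : AddCircle (1 : ℝ)) = v := by
    simp only [hT, AddCircle.toCircle_apply_mk, Circle.coe_exp]
    have : ((2 * Real.pi / 1 * (θ / (2 * Real.pi)) : ℝ) : ℂ) = θ := by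
      congr 1; field_simp
    rw [this, hθ, div_mul_cancel₀ _ hu]
  have hopen : IsOpen (T ⁻¹' ball v ε) := isOpen_ball.preimage hTc
  obtain ⟨n, hn⟩ := hd.exists_mem_open hopen ⟨_, by
    rw [Set.mem_preimage, hTv]; exact mem_ball_self hε⟩
  refine ⟨n, ?_⟩
  rw [Set.mem_preimage, mem_ball, dist_eq_norm] at hn
  have key : T (n • (α : AddCircle (1 : ℝ))) =
      Complex.exp (2 * Real.pi * Complex.I * α) ^ n * u := by
    simp only [hT, AddCircle.toCircle_nsmul, Circle.coe_pow, AddCircle.toCircle_apply_mk,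
      Circle.coe_exp]
    congr 3
    push_cast
    ring
  rwa [key] at hn

/-- A forward invariant open set that meets a Siegel disk contains an invariant circle `C` around
the center; `D` is the closed disk bounded by `C`. -/
lemma IsSiegelDisk.exists_invariant_circle {c : ℂ} {m : ℕ} {Δ : Set ℂ} {ζ : ℂ}
    (h : IsSiegelDisk c m Δ ζ) {W : Set ℂ} (hW : IsOpen W)
    (hinv : ∀ w n, w ∈ W → (f c)^[n] w ∈ W) {w₀ : ℂ} (hw₀ : w₀ ∈ Δ) (hw₀W : w₀ ∈ W) :
    ∃ D C : Set ℂ, IsCompact D ∧ IsCompact C ∧ IsPreconnected C ∧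
      IsOpen (D \ C) ∧ ζ ∈ D \ C ∧ D ⊆ interior (K c) ∧ C ⊆ W := by
  obtain ⟨hm, hO, -, hζ, him, -, α, hα, φ, hφ, hbij, hφ0, hrot⟩ := h
  set F := (f c)^[m] with hF
  set e := Complex.exp (2 * Real.pi * Complex.I * α) with he
  have hnorm : ‖e‖ = 1 := by
    rw [he, show (2 * Real.pi * Complex.I * α : ℂ) = ((2 * Real.pi * α : ℝ) : ℂ) * Complex.I by
      push_cast; ring]
    exact Complex.norm_exp_ofReal_mul_I _
  have hmaps : Set.MapsTo F Δ Δ := fun w hw => him ▸ Set.mem_image_of_mem F hw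
  have hiter : ∀ n, ∀ w ∈ Δ, F^[n] w ∈ Δ ∧ φ (F^[n] w) = e ^ n * φ w := by
    intro n
    induction n with
    | zero => intro w hw; simpa using hw
    | succ n ih =>
      intro w hw
      obtain ⟨h1, h2⟩ := ih w hw
      rw [Function.iterate_succ_apply']
      refine ⟨hmaps h1, ?_⟩
      rw [hrot _ h1, h2, pow_succ']
      ring
  set ψ := Function.invFunOn φ Δ with hψ
  have hψm : ∀ y ∈ ball (0 : ℂ) 1, ψ y ∈ Δ := fun y hy =>
    Function.invFunOn_mem (hbij.surjOn hy)
  have hφψ : ∀ y ∈ ball (0 : ℂ) 1, φ (ψ y) = y := fun y hy =>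
    Function.invFunOn_eq (hbij.surjOn hy)
  have hψφ : ∀ w ∈ Δ, ψ (φ w) = w := fun w hw =>
    hbij.injOn (hψm _ (hbij.mapsTo hw)) hw (hφψ _ (hbij.mapsTo hw))
  have hψc : ContinuousOn ψ (ball 0 1) := by
    intro y hy
    obtain ⟨w, hw, rfl⟩ := hbij.surjOn hy
    apply ContinuousAt.continuousWithinAt
    have hnhds : Δ ∈ 𝓝 w := hO.mem_nhds hw
    have han : AnalyticAt ℂ φ w := hφ.analyticAt hnhds
    rcases han.eventually_constant_or_nhds_le_map_nhds with h0 | hle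
    · exfalso
      have h1 : ∀ᶠ z in 𝓝[≠] w, φ z = φ w ∧ z ∈ Δ ∧ z ≠ w :=
        (h0.filter_mono nhdsWithin_le_nhds).and
          ((eventually_mem_set.2 (mem_nhdsWithin_of_mem_nhds hnhds)).and self_mem_nhdsWithin)
      obtain ⟨z, h2, h3, h4⟩ := h1.exists
      exact h4 (hbij.injOn h3 hw h2)
    · rw [ContinuousAt, hψφ w hw]
      refine Tendsto.mono_left ?_ hle
      rw [tendsto_map'_iff]
      exact tendsto_id.congr' (by filter_upwards [hnhds] with z hz using (hψφ z hz).symm)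
  have hΔK : Δ ⊆ K c := by
    intro w hw
    have hr : ‖φ w‖ < 1 := by simpa using hbij.mapsTo hw
    have hcomp : IsCompact (ψ '' closedBall 0 ‖φ w‖) :=
      (isCompact_closedBall _ _).image_of_continuousOn (hψc.mono (closedBall_subset_ball hr))
    have hcomp' : IsCompact (⋃ j ∈ Finset.range m, (f c)^[j] '' (ψ '' closedBall 0 ‖φ w‖)) :=
      (Finset.range m).isCompact_biUnion fun j _ => hcomp.image (continuous_iterate c j)
    obtain ⟨R, hR⟩ := hcomp'.isBounded.exists_norm_le
    refine mem_K_of_forall_norm_le (R := R) fun n => hR _ ?_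
    obtain ⟨h1, h2⟩ := hiter (n / m) w hw
    refine Set.mem_biUnion (x := n % m) (Finset.mem_coe.2 (Finset.mem_range.2
      (Nat.mod_lt _ hm))) ⟨F^[n / m] w, ⟨φ (F^[n / m] w), ?_, hψφ _ h1⟩, ?_⟩
    · simp [h2, hnorm]
    · rw [hF, ← Function.iterate_mul, ← Function.iterate_add_apply, Nat.mod_add_div]
  obtain ⟨w₁, ⟨hw₁, hw₁W⟩, hw₁ζ⟩ : ∃ w, w ∈ Δ ∩ W ∧ w ≠ ζ := by
    have h1 : ∀ᶠ w in 𝓝[≠] w₀, w ∈ Δ ∩ W :=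
      mem_nhdsWithin_of_mem_nhds ((hO.inter hW).mem_nhds ⟨hw₀, hw₀W⟩)
    by_cases h2 : w₀ = ζ
    · subst h2
      obtain ⟨w, h3, h4⟩ := (h1.and self_mem_nhdsWithin).exists
      exact ⟨w, h3, h4⟩
    · exact ⟨w₀, ⟨hw₀, hw₀W⟩, h2⟩
  set r := ‖φ w₁‖ with hr
  have hr1 : r < 1 := by simpa using hbij.mapsTo hw₁
  have hr0 : 0 < r := by
    rw [hr, norm_pos_iff]
    exact fun h0 => hw₁ζ (hbij.injOn hw₁ hζ (h0.trans hφ0.symm))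
  have hcb : closedBall (0 : ℂ) r ⊆ ball 0 1 := closedBall_subset_ball hr1
  have hsb : sphere (0 : ℂ) r ⊆ ball 0 1 := sphere_subset_closedBall.trans hcb
  have hdiff : ψ '' closedBall 0 r \ ψ '' sphere 0 r = Δ ∩ φ ⁻¹' ball 0 r := by
    ext w
    constructor
    · rintro ⟨⟨y, hy, rfl⟩, h2⟩
      refine ⟨hψm y (hcb hy), ?_⟩
      rw [Set.mem_preimage, hφψ y (hcb hy)]
      rw [mem_ball_zero_iff]
      refine lt_of_le_of_ne (by simpa using hy) fun h3 => h2 ⟨y, by simpa using h3, rfl⟩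
    · rintro ⟨h1, h2⟩
      refine ⟨⟨φ w, ball_subset_closedBall h2, hψφ w h1⟩, ?_⟩
      rintro ⟨y, hy, rfl⟩
      rw [Set.mem_preimage, hφψ y (hsb hy), mem_ball_zero_iff] at h2
      rw [mem_sphere_zero_iff_norm] at hy
      exact h2.ne hy
  refine ⟨ψ '' closedBall 0 r, ψ '' sphere 0 r,
    (isCompact_closedBall _ _).image_of_continuousOn (hψc.mono hcb),
    (isCompact_sphere _ _).image_of_continuousOn (hψc.mono hsb),
    (isPreconnected_sphere (by simp [Complex.rank_real_complex]) _ _).image _ (hψc.mono hsb),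
    hdiff ▸ hφ.continuousOn.isOpen_inter_preimage hO isOpen_ball,
    hdiff ▸ ⟨hζ, by simpa [hφ0] using hr0⟩, ?_, ?_⟩
  · rintro _ ⟨y, hy, rfl⟩
    exact interior_maximal hΔK hO (hψm y (hcb hy))
  · rintro _ ⟨y, hy, rfl⟩
    have hW' : ψ ⁻¹' W ∈ 𝓝 (φ w₁) := by
      have hc : ContinuousAt ψ (φ w₁) := hψc.continuousAt (isOpen_ball.mem_nhds (hbij.mapsTo hw₁))
      exact hc (hW.mem_nhds (by rwa [hψφ _ hw₁]))
    obtain ⟨ε, hε, hsub⟩ := Metric.mem_nhds_iff.1 hW'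
    have hyr : ‖y‖ = r := by simpa using hy
    obtain ⟨n, hn⟩ := exists_norm_exp_pow_mul_sub_lt hα (hr.symm.trans hyr.symm) hε
    have he0 : e ≠ 0 := Complex.exp_ne_zero _
    set y' := (e ^ n)⁻¹ * y with hy'
    have hy'n : ‖y' - φ w₁‖ < ε := by
      have : y' - φ w₁ = -((e ^ n)⁻¹ * (e ^ n * φ w₁ - y)) := by
        rw [hy']; field_simp; ring
      rw [this, norm_neg, norm_mul, norm_inv, norm_pow, hnorm]
      simpa using hn
    have hy'b : y' ∈ ball (0 : ℂ) 1 := by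
      rw [mem_ball_zero_iff, hy', norm_mul, norm_inv, norm_pow, hnorm, hyr]
      simpa using hr1
    have hy'W : ψ y' ∈ W := hsub (by rwa [mem_ball, dist_eq_norm])
    obtain ⟨h1, h2⟩ := hiter n _ (hψm y' hy'b)
    have h3 : F^[n] (ψ y') = ψ y := by
      refine hbij.injOn h1 (hψm y (hsb hy)) ?_
      rw [h2, hφψ y' hy'b, hφψ y (hsb hy), hy']
      field_simp
    rw [← h3, hF, ← Function.iterate_mul]
    exact hinv _ _ hy'W

/-- The maps `(z, c) ↦ ((f c)^[n] z, c)` are open. -/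
lemma eventually_exists_iterate_eq (c₀ : ℂ) (n : ℕ) : ∀ {z₀ : ℂ} {U : Set ℂ}, U ∈ 𝓝 z₀ →
    ∀ᶠ p : ℂ × ℂ in 𝓝 ((f c₀)^[n] z₀, c₀), ∃ z ∈ U, (f p.2)^[n] z = p.1 := by
  have base : ∀ {z₀ : ℂ} {U : Set ℂ}, U ∈ 𝓝 z₀ →
      ∀ᶠ p : ℂ × ℂ in 𝓝 (f c₀ z₀, c₀), ∃ z ∈ U, f p.2 z = p.1 := by
    intro z₀ U hU
    obtain ⟨ε, hε, hsub⟩ := Metric.mem_nhds_iff.1 hU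
    have hc : Continuous fun p : ℂ × ℂ => ‖p.1 - p.2 - z₀ ^ 2‖ := by fun_prop
    have h0 : ‖f c₀ z₀ - c₀ - z₀ ^ 2‖ < ε ^ 2 := by
      simpa [f] using pow_pos hε 2
    filter_upwards [hc.continuousAt.eventually_lt continuousAt_const h0] with p hp
    obtain ⟨s, hs, hs'⟩ := exists_sq_eq_norm_sub_lt hε hp
    exact ⟨s, hsub (by rwa [mem_ball, dist_eq_norm]), by simp [f, hs]⟩
  induction n with
  | zero =>
    intro z₀ U hU
    filter_upwards [continuousAt_fst.eventually (eventually_mem_set.2 hU)] with p hp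
    exact ⟨p.1, hp, rfl⟩
  | succ n ih =>
    intro z₀ U hU
    obtain ⟨U', hU', V', hV', hsub⟩ := mem_nhds_prod_iff.1 (base hU)
    filter_upwards [ih hU', continuousAt_snd.eventually (eventually_mem_set.2 hV')] with p hp hp'
    obtain ⟨w, hw, hwp⟩ := hp
    obtain ⟨z, hz, hzw⟩ := hsub (Set.mk_mem_prod hw hp')
    exact ⟨z, hz, by rw [Function.iterate_succ_apply, hzw, hwp]⟩

/-- If the boundary of a disk stays away from the Julia sets, then the disk avoids the preimages
of a moving point of the Julia set as soon as it does so for one parameter. -/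
lemma iterate_ne_of_disjoint_J {D C V : Set ℂ} {B : ℂ → ℂ} {c : ℂ} (hD : IsCompact D)
    (hDC : IsOpen (D \ C)) (hV : IsOpen V) (hVc : IsPreconnected V) (hc : c ∈ V)
    (hDK : D ⊆ interior (K c)) (hCJ : ∀ c' ∈ V, ∀ w ∈ C, w ∉ J c') (hB : ContinuousOn B V)
    (hBJ : ∀ c' ∈ V, B c' ∈ J c') (n : ℕ) {c' : ℂ} (hc' : c' ∈ V) {z : ℂ} (hz : z ∈ D) :
    (f c')^[n] z ≠ B c' := by
  set S : Set ℂ := {a | a ∈ V ∧ ∃ z ∈ D, (f a)^[n] z = B a} with hS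
  set T : Set ℂ := {a | a ∈ V ∧ ∀ z ∈ D, (f a)^[n] z ≠ B a} with hT
  have hSo : IsOpen S := by
    rw [isOpen_iff_eventually]
    rintro a ⟨ha, z₀, hz₀, hza⟩
    have hz₀C : z₀ ∉ C := fun h => hCJ a ha z₀ h ((iterate_mem_J_iff n).1 (hza ▸ hBJ a ha))
    have hBa : ContinuousAt B a := hB.continuousAt (hV.mem_nhds ha)
    have h1 := eventually_exists_iterate_eq a n (hDC.mem_nhds ⟨hz₀, hz₀C⟩)
    rw [hza] at h1
    have h2 : ContinuousAt (fun a => (B a, a)) a := hBa.prodMk continuousAt_id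
    filter_upwards [h2.eventually h1, hV.mem_nhds ha] with b hb hbV
    obtain ⟨z, hz, hzb⟩ := hb
    exact ⟨hbV, z, hz.1, hzb⟩
  have hTo : IsOpen T := by
    rw [isOpen_iff_eventually]
    rintro a ⟨ha, hza⟩
    have hBa : ContinuousAt B a := hB.continuousAt (hV.mem_nhds ha)
    have h1 : ∀ᶠ b in 𝓝 a, ∀ z ∈ D, (f b)^[n] z ≠ B b := by
      refine hD.eventually_forall_of_forall_eventually fun z hz => ?_
      have hl : ContinuousAt (fun p : ℂ × ℂ => (f p.1)^[n] p.2) (a, z) :=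
        ((continuous_iterate_prod n).comp continuous_swap).continuousAt
      have hr : ContinuousAt (fun p : ℂ × ℂ => B p.1) (a, z) :=
        ContinuousAt.comp (f := Prod.fst) hBa continuousAt_fst
      exact (hl.prodMk hr).eventually
        (isClosed_diagonal.isOpen_compl.mem_nhds (hza z hz))
    filter_upwards [h1, hV.mem_nhds ha] with b hb hbV using ⟨hbV, hb⟩
  have hcT : c ∈ T := ⟨hc, fun z hz h =>
    ((iterate_mem_J_iff n).1 (h ▸ hBJ c hc)).2 (hDK hz)⟩
  intro hcon
  obtain ⟨a, -, ⟨-, z, hz, h1⟩, -, h2⟩ := hVc S T hSo hTo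
    (fun a ha => by
      by_cases h : ∃ z ∈ D, (f a)^[n] z = B a
      · exact Or.inl ⟨ha, h⟩
      · exact Or.inr ⟨ha, fun z hz hzb => h ⟨z, hz, hzb⟩⟩)
    ⟨c', hc', hc', z, hz, hcon⟩ ⟨c, hc, hcT⟩
  exact h2 z hz h1

/-- A disk that contains a point of the filled Julia set, whose boundary avoids the Julia set, and
which avoids all preimages of a point of the filled Julia set, lies in the filled Julia set. -/
lemma subset_K_of_iterate_ne {D C : Set ℂ} {c z β : ℂ} (hD : IsCompact D) (hC : IsCompact C)
    (hCp : IsPreconnected C) (hDC : IsOpen (D \ C))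
    (hCJ : ∀ w ∈ C, w ∉ J c) (hz : z ∈ D \ C) (hzK : z ∈ K c) (hβ : β ∈ K c)
    (hne : ∀ n, ∀ w ∈ D, (f c)^[n] w ≠ β) : D ⊆ K c := by
  have hbd : Bornology.IsBounded (D \ C) := hD.isBounded.subset Set.sdiff_subset
  have hcl : closure (D \ C) ⊆ D := closure_minimal Set.sdiff_subset hD.isClosed
  have hfr : frontier (D \ C) ⊆ C := by
    intro w hw
    by_contra h
    rw [hDC.frontier_eq] at hw
    exact hw.2 ⟨hcl hw.1, h⟩
  set R := 2 + ‖c‖ with hR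
  have hR0 : 0 < R := by positivity
  have hCK : C ⊆ K c := by
    by_contra hCK
    have hdis : ∀ w ∈ C, w ∉ K c := by
      intro w hw hwK
      have hKint : ∀ v ∈ C, v ∈ K c → v ∈ interior (K c) := fun v hv hvK => by
        by_contra h
        exact hCJ v hv ⟨subset_closure hvK, h⟩
      obtain ⟨v, hv, hvK⟩ := Set.not_subset.1 hCK
      obtain ⟨u, -, hu, hu'⟩ := hCp (interior (K c)) (K c)ᶜ isOpen_interior
        (isClosed_K c).isOpen_compl
        (fun u hu => (em (u ∈ K c)).imp_left (hKint u hu)) ⟨w, hw, hKint w hw hwK⟩ ⟨v, hv, hvK⟩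
      exact hu' (interior_subset hu)
    obtain ⟨N, hN⟩ : ∃ N, C ⊆ {w | 4 * R < ‖(f c)^[N] w‖} := by
      refine hC.elim_directed_cover _
        (fun n => isOpen_lt continuous_const (continuous_iterate c n).norm) ?_ ?_
      · intro w hw
        by_contra h
        simp only [Set.mem_iUnion, Set.mem_ofPred_eq, not_exists, not_lt] at h
        exact hdis w hw (mem_K_of_forall_norm_le h)
      · refine (monotone_nat_of_le_succ fun n w hw => ?_).directed_le
        have hw' : 4 * R < ‖(f c)^[n] w‖ := hw
        change 4 * R < ‖(f c)^[n + 1] w‖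
        rw [Function.iterate_succ_apply']
        have := two_mul_norm_le_norm_apply (c := c) (z := (f c)^[n] w) (by linarith)
        linarith
    have hβR : ‖β‖ ≤ R := norm_le_of_mem_K hβ
    have hd : DiffContOnCl ℂ (fun w => ((f c)^[N] w - β)⁻¹) (D \ C) := by
      refine DifferentiableOn.diffContOnCl fun w hw => ?_
      exact (((differentiable_iterate c N w).sub_const β).inv
        (sub_ne_zero.2 (hne N w (hcl hw)))).differentiableWithinAt
    have hmax := Complex.norm_le_of_forall_mem_frontier_norm_le hbd hd (C := (3 * R)⁻¹)
      (fun w hw => by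
        have h1 : 4 * R < ‖(f c)^[N] w‖ := hN (hfr hw)
        have h2 := norm_sub_norm_le ((f c)^[N] w) β
        rw [norm_inv]
        exact inv_anti₀ (by positivity) (by linarith)) (subset_closure hz)
    rw [norm_inv, inv_le_inv₀ (norm_pos_iff.2 (sub_ne_zero.2 (hne N z hz.1)))
      (by positivity)] at hmax
    have h3 := norm_iterate_le_of_mem_K hzK N
    have h4 := norm_sub_le ((f c)^[N] z) β
    linarith
  intro w hw
  by_cases hwC : w ∈ C
  · exact hCK hwC
  · refine mem_K_of_forall_norm_le (R := R) fun n => ?_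
    exact Complex.norm_le_of_forall_mem_frontier_norm_le hbd
      (differentiable_iterate c n).diffContOnCl
      (fun v hv => norm_iterate_le_of_mem_K (hCK (hfr hv)) n) (subset_closure ⟨hw, hwC⟩)

/-- If the orbit of `z` under `f_c` enters a Siegel disk of `f_c`, then `(z,c) ∈ 𝕁`:
arbitrarily small perturbations `(z̃, c̃)` of `(z, c)` satisfy `z̃ ∈ J_{c̃}`. -/
theorem mem_bbJ_of_orbit_hits_siegelDisk (c : ℂ) (m : ℕ) (Δ : Set ℂ) (ζ : ℂ)
    (hΔ : IsSiegelDisk c m Δ ζ) (z : ℂ) (k : ℕ) (hz : (f c)^[k] z ∈ Δ) :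
    (z, c) ∈ bbJ := by
  by_contra hzJ
  have hW : IsOpen {w : ℂ | (w, c) ∉ bbJ} :=
    (isClosed_closure.preimage (Continuous.prodMk_left c)).isOpen_compl
  obtain ⟨D, C, hD, hC, hCp, hDC, hζD, hDK, hCW⟩ :=
    hΔ.exists_invariant_circle hW (fun w n hw h => hw (mem_bbJ_of_iterate_mem n h)) hz
      (fun h => hzJ (mem_bbJ_of_iterate_mem k h))
  obtain ⟨hlam, hlam1⟩ := hΔ.norm_multiplier
  have hm : m ≠ 0 := Nat.one_le_iff_ne_zero.1 hΔ.1
  have hfix : (f c)^[m] ζ = ζ := hΔ.2.2.2.2.2.1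
  obtain ⟨Z, hZc, hZd, hZ⟩ := exists_periodic_continuation hfix hlam1
  obtain ⟨q, β, hq, hβ, hβ1⟩ := exists_repelling c
  obtain ⟨B, hBc, hBd, hB⟩ := exists_periodic_continuation hβ
    (fun h => by rw [h, norm_one] at hβ1; exact lt_irrefl _ hβ1)
  have hZcont : ContinuousAt Z c := hZd.self_of_nhds.continuousAt
  have hBcont : ContinuousAt B c := hBd.self_of_nhds.continuousAt
  have hB1 : ∀ᶠ c' in 𝓝 c, 1 < ‖deriv (f c')^[q] (B c')‖ := by
    have h1 : ContinuousAt (fun c' => ‖deriv (f c')^[q] (B c')‖) c :=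
      (ContinuousAt.comp (f := fun c' => (B c', c'))
        (contDiff_deriv_iterate q).continuous.continuousAt
        (hBcont.prodMk continuousAt_id)).norm
    exact continuousAt_const.eventually_lt h1 (by simpa [hBc] using hβ1)
  have hZD : ∀ᶠ c' in 𝓝 c, Z c' ∈ D \ C :=
    hZcont.eventually (eventually_mem_set.2 (hDC.mem_nhds (hZc ▸ hζD)))
  have hCJ : ∀ᶠ c' in 𝓝 c, ∀ w ∈ C, (w, c') ∉ bbJ := by
    refine hC.eventually_forall_of_forall_eventually fun w hw => ?_
    have h1 : (w, c) ∈ bbJᶜ := hCW hw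
    exact (continuous_swap.continuousAt (x := (c, w))).eventually
      (isClosed_closure.isOpen_compl.mem_nhds h1)
  obtain ⟨ε, hε, hball⟩ := Metric.eventually_nhds_iff_ball.1
    (hZd.and (hZ.and (hBd.and (hB.and (hB1.and (hZD.and hCJ))))))
  choose! hZd hZ hBd hB hB1 hZD hCJ using hball
  have hCJ' : ∀ c' ∈ ball c ε, ∀ w ∈ C, w ∉ J c' := fun c' hc' w hw h =>
    hCJ c' hc' w hw (subset_closure h)
  have hsub : ∀ c' ∈ ball c ε, D ⊆ K c' := fun c' hc' =>
    subset_K_of_iterate_ne hD hC hCp hDC (hCJ' c' hc') (hZD c' hc')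
      (mem_K_of_iterate_eq hm (hZ c' hc')) (mem_K_of_iterate_eq hq (hB c' hc'))
      fun n w hw => iterate_ne_of_disjoint_J hD hDC isOpen_ball
        (convex_ball c ε).isPreconnected (mem_ball_self hε) hDK hCJ'
        (fun a ha => (hBd a ha).continuousAt.continuousWithinAt)
        (fun a ha => mem_J_of_one_lt_norm_deriv hq (hB a ha) (hB1 a ha)) n hc' hw
  set lam : ℂ → ℂ := fun c' => deriv (f c')^[m] (Z c') with hlamdef
  have hle : ∀ c' ∈ ball c ε, ‖lam c'‖ ≤ 1 := fun c' hc' =>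
    norm_deriv_iterate_le_one_of_mem_interior (hZ c' hc')
      (interior_maximal (Set.sdiff_subset.trans (hsub c' hc')) hDC (hZD c' hc'))
  have hlamc : ‖lam c‖ = 1 := by simpa [hlamdef, hZc] using hlam
  have hdiff : ∀ᶠ c' in 𝓝 c, DifferentiableAt ℂ lam c' := by
    filter_upwards [ball_mem_nhds c hε] with a ha
    exact DifferentiableAt.comp (f := fun c' => (Z c', c')) a
      ((contDiff_deriv_iterate m).differentiable one_ne_zero _)
      ((hZd a ha).prodMk differentiableAt_id)
  have hmax : IsLocalMax (norm ∘ lam) c := by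
    filter_upwards [ball_mem_nhds c hε] with a ha
    simpa [hlamc] using hle a ha
  have hconst := Complex.eventually_eq_of_isLocalMax_norm hdiff hmax
  have hnhds : {a | ∃ w, (f a)^[m] w = w ∧ deriv (f a)^[m] w = lam c} ∈ 𝓝 c := by
    filter_upwards [hconst, ball_mem_nhds c hε] with a ha hab
    exact ⟨Z a, hZ a hab, ha⟩
  exact infinite_of_mem_nhds c hnhds (finite_setOf_exists_multiplier_eq hm hlamc)
end
end

section
/- For every real d > 0, the set 𝕁 ∩ (ℂ × {c ∈ ℂ : |c| ≤ d}) is a compact subset of ℂ × ℂ. -/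
open Filter Metric Topology

noncomputable section

theorem two_mul_norm_le_norm_f {c z : ℂ} (hz : ‖c‖ + 2 ≤ ‖z‖) : 2 * ‖z‖ ≤ ‖f c z‖ := by
  have h : ‖z‖ ^ 2 - ‖c‖ ≤ ‖f c z‖ := by
    rw [← norm_pow]
    simpa only [f, norm_neg, sub_neg_eq_add] using norm_sub_norm_le (z ^ 2) (-c)
  nlinarith [norm_nonneg c, norm_nonneg z]

theorem two_pow_mul_norm_le_norm_iterate_f {c z : ℂ} (hz : ‖c‖ + 2 ≤ ‖z‖) (n : ℕ) :
    2 ^ n * ‖z‖ ≤ ‖(f c)^[n] z‖ := by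
  induction n with
  | zero => simp
  | succ n ih =>
    rw [Function.iterate_succ_apply']
    have h : ‖z‖ ≤ 2 ^ n * ‖z‖ :=
      le_mul_of_one_le_left (norm_nonneg z) (one_le_pow₀ one_le_two)
    have := two_mul_norm_le_norm_f (hz.trans (h.trans ih))
    rw [pow_succ]
    linarith

theorem K_subset_closedBall (c : ℂ) : K c ⊆ closedBall 0 (‖c‖ + 2) := by
  intro z hz
  rw [mem_closedBall_zero_iff]
  by_contra! h
  have hbdd : Bornology.IsBounded (Set.range fun n => (f c)^[n] z) := hz
  obtain ⟨M, hM⟩ := hbdd.exists_norm_le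
  obtain ⟨n, hn⟩ := pow_unbounded_of_one_lt M (one_lt_two (α := ℝ))
  have hle := (two_pow_mul_norm_le_norm_iterate_f h.le n).trans (hM _ ⟨n, rfl⟩)
  have hone : (1 : ℝ) ≤ ‖z‖ := by linarith [norm_nonneg c]
  exact absurd (hn.trans_le (le_mul_of_one_le_right (by positivity) hone)) hle.not_gt

theorem J_subset_closedBall (c : ℂ) : J c ⊆ closedBall 0 (‖c‖ + 2) :=
  frontier_subset_closure.trans (closure_minimal (K_subset_closedBall c) isClosed_closedBall)

theorem norm_fst_le_of_mem_bbJ {p : ℂ × ℂ} (hp : p ∈ bbJ) : ‖p.1‖ ≤ ‖p.2‖ + 2 := by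
  have hclosed : IsClosed {p : ℂ × ℂ | ‖p.1‖ ≤ ‖p.2‖ + 2} :=
    isClosed_le (by fun_prop) (by fun_prop)
  exact closure_minimal (fun q hq => mem_closedBall_zero_iff.mp (J_subset_closedBall q.2 hq))
    hclosed hp

/-- For every `d > 0`, the part of `𝕁` with `|c| ≤ d` is compact. -/
theorem bbJ_inter_compact (d : ℝ) (hd : 0 < d) :
    IsCompact (bbJ ∩ (Set.univ ×ˢ Metric.closedBall (0 : ℂ) d)) := by
  refine ((isCompact_closedBall (0 : ℂ) (d + 2)).prod
    (isCompact_closedBall (0 : ℂ) d)).of_isClosed_subset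
    (isClosed_closure.inter (isClosed_univ.prod isClosed_closedBall)) ?_
  rintro p ⟨hp, -, hd'⟩
  have := norm_fst_le_of_mem_bbJ hp
  rw [mem_closedBall_zero_iff] at hd'
  exact ⟨mem_closedBall_zero_iff.mpr (by linarith), mem_closedBall_zero_iff.mpr hd'⟩
end
end

section
/- For every set S of positive integers, the union of Ω_S with all bounded connected components of ℂ ∖ Ω_S equals the closed unit disk {z ∈ ℂ : |z| ≤ 1}. In other words, the filled-in version of every set Ω_S is the closed unit disk. -/
open Filter Metric Topology

noncomputable section

/-- The radial spoke `L_k = {r·e^{2πi/k} : r ∈ [1 − 1/k, 1]}`. -/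
def L (k : ℕ) : Set ℂ :=
  {z : ℂ | ∃ r : ℝ, r ∈ Set.Icc (1 - 1 / (k : ℝ)) 1 ∧
    z = (r : ℂ) * Complex.exp (2 * Real.pi * Complex.I / k)}

/-- The set `Ω_S`: the unit circle together with the spokes `L_k` for `k ∈ S`. -/
def Om (S : Set ℕ) : Set ℂ := Metric.sphere (0 : ℂ) 1 ∪ ⋃ k ∈ S, L k

theorem norm_le_one_of_mem_Om {S : Set ℕ} (hS : ∀ k ∈ S, 1 ≤ k) {z : ℂ} (hz : z ∈ Om S) :
    ‖z‖ ≤ 1 := by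
  rcases hz with hz | hz
  · exact (mem_sphere_zero_iff_norm.1 hz).le
  · obtain ⟨k, hk, r, ⟨hr₀, hr₁⟩, rfl⟩ := Set.mem_iUnion₂.1 hz
    have hk1 : (1 : ℝ) ≤ k := by exact_mod_cast hS k hk
    have hinv : 1 / (k : ℝ) ≤ 1 := by
      rw [div_le_one (by linarith)]
      exact hk1
    have hexp : (2 * Real.pi * Complex.I / k : ℂ) = ((2 * Real.pi / k : ℝ) : ℂ) * Complex.I := by
      push_cast
      ring
    rw [hexp, norm_mul, Complex.norm_exp_ofReal_mul_I, mul_one, Complex.norm_real,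
      Real.norm_of_nonneg (by linarith)]
    exact hr₁

/-- A preconnected set that misses the unit sphere and meets the unit ball lies in the ball. -/
theorem IsPreconnected.norm_le_one_of_disjoint_sphere {E : Type*} [SeminormedAddCommGroup E]
    {C : Set E} (hC : IsPreconnected C) (hd : Disjoint C (Metric.sphere (0 : E) 1)) {z w : E}
    (hz : z ∈ C) (hz1 : ‖z‖ ≤ 1) (hw : w ∈ C) : ‖w‖ ≤ 1 := by
  by_contra! h
  obtain ⟨x, hx, hx1⟩ := hC.intermediate_value hz hw continuous_norm.continuousOn ⟨hz1, h.le⟩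
  exact Set.disjoint_left.1 hd hx (mem_sphere_zero_iff_norm.2 hx1)

/-- Outside the closed unit ball, a set whose complement lies in that ball has only unbounded
components. -/
theorem not_isBounded_connectedComponentIn {E : Type*} [NormedAddCommGroup E] [NormedSpace ℝ E]
    {U : Set E} (hU : ∀ w : E, 1 < ‖w‖ → w ∈ U) {z : E} (hz : 1 < ‖z‖) :
    ¬ Bornology.IsBounded (connectedComponentIn U z) := by
  intro hb
  obtain ⟨R, hR⟩ := hb.exists_norm_le
  have hnorm : ∀ t : ℝ, 1 ≤ t → t < ‖t • z‖ := fun t ht => by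
    rw [norm_smul, Real.norm_of_nonneg (by linarith)]
    nlinarith
  have hray : (fun t : ℝ => t • z) '' Set.Ici 1 ⊆ connectedComponentIn U z := by
    refine IsPreconnected.subset_connectedComponentIn
      (isPreconnected_Ici.image _ (by fun_prop)) ⟨1, Set.self_mem_Ici, one_smul ℝ z⟩ ?_
    rintro _ ⟨t, ht, rfl⟩
    exact hU _ (lt_of_le_of_lt ht (hnorm t ht))
  have h1 : (1 : ℝ) ≤ max 1 R := le_max_left _ _
  have h2 := hR _ (hray ⟨max 1 R, h1, rfl⟩)
  exact absurd (le_max_right 1 R) (not_le.2 ((hnorm _ h1).trans_le h2))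

/-- Filling in `Ω_S` (adjoining all bounded connected components of its complement)
always yields the closed unit disk. -/
theorem filled_Om_eq_closedBall (S : Set ℕ) (hS : ∀ k ∈ S, 1 ≤ k) :
    Om S ∪ {z : ℂ | z ∉ Om S ∧ Bornology.IsBounded (connectedComponentIn (Om S)ᶜ z)} =
      Metric.closedBall (0 : ℂ) 1 := by
  ext z
  rw [mem_closedBall_zero_iff]
  constructor
  · rintro (hz | ⟨-, hb⟩)
    · exact norm_le_one_of_mem_Om hS hz
    · by_contra! hz
      exact not_isBounded_connectedComponentIn
        (fun w hw hmem => (norm_le_one_of_mem_Om hS hmem).not_gt hw) hz hb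
  · intro hz
    by_cases hmem : z ∈ Om S
    · exact Or.inl hmem
    · refine Or.inr ⟨hmem, isBounded_iff_forall_norm_le.2 ⟨1, fun w hw => ?_⟩⟩
      refine isPreconnected_connectedComponentIn.norm_le_one_of_disjoint_sphere
        (Set.disjoint_left.2 fun x hx hxs => ?_) (mem_connectedComponentIn hmem) hz hw
      exact connectedComponentIn_subset _ _ hx (Or.inl hxs)
end
end

section
/- Let A be an arbitrary set of positive integers, set Ω_1 = Ω_A, and let W be the closure in ℂ × ℝ of the set {(z,t) : t ∈ (0,1], z ∈ Ω_t}. Then the slice of W at t = 1 satisfies {z ∈ ℂ : (z,1) ∈ W} = S¹ ∪ ⋃_{k ≥ 1} L_k, independently of the choice of A. In particular this slice contains Ω_1. -/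
open Filter Metric Topology

noncomputable section

/-- The `k`-th binary digit of `t` (terminating expansion for dyadic rationals). -/
def digit (k : ℕ) (t : ℝ) : ℤ := ⌊(2 : ℝ) ^ k * t⌋ % 2

/-- The set of positions `k ≥ 1` where the binary expansion of `t` has digit `1`. -/
def Sdig (t : ℝ) : Set ℕ := {k : ℕ | 1 ≤ k ∧ digit k t = 1}

/-- The family `t ↦ Ω_t` for `t ∈ (0,1]`, where at `t = 1` we use the arbitrary set `A`. -/
def OmT (A : Set ℕ) (t : ℝ) : Set ℂ := if t = 1 then Om A else Om (Sdig t)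

lemma isClosed_L (k : ℕ) : IsClosed (L k) := by
  have h : L k = (fun r : ℝ => (r : ℂ) * Complex.exp (2 * Real.pi * Complex.I / k)) ''
      Set.Icc (1 - 1 / (k : ℝ)) 1 := by
    ext z
    simp only [L, Set.mem_ofPred_eq, Set.mem_image, eq_comm]
  rw [h]
  exact (isCompact_Icc.image (by fun_prop)).isClosed

lemma norm_mem_Icc_of_mem_L {k : ℕ} (hk : 1 ≤ k) {z : ℂ} (hz : z ∈ L k) :
    ‖z‖ ∈ Set.Icc (1 - 1 / (k : ℝ)) 1 := by
  obtain ⟨r, hr, rfl⟩ := hz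
  have hexp : ‖Complex.exp (2 * Real.pi * Complex.I / k)‖ = 1 := by
    have : (2 * Real.pi * Complex.I / k : ℂ) = ((2 * Real.pi / k : ℝ) : ℂ) * Complex.I := by
      push_cast
      ring
    rw [this, Complex.norm_exp_ofReal_mul_I]
  have hk' : 1 / (k : ℝ) ≤ 1 := by
    rw [div_le_one (by positivity)]
    exact_mod_cast hk
  rwa [norm_mul, hexp, mul_one, Complex.norm_real, Real.norm_of_nonneg (by linarith [hr.1])]

lemma Om_mono {S T : Set ℕ} (h : S ⊆ T) : Om S ⊆ Om T :=
  Set.union_subset_union_right _ (Set.biUnion_subset_biUnion_left h)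

lemma Om_subset_closedBall {S : Set ℕ} (hS : ∀ k ∈ S, 1 ≤ k) : Om S ⊆ closedBall 0 1 := by
  refine Set.union_subset sphere_subset_closedBall (Set.iUnion₂_subset fun k hk z hz => ?_)
  simpa using (norm_mem_Icc_of_mem_L (hS k hk) hz).2

lemma isClosed_Om {S : Set ℕ} (hS : ∀ k ∈ S, 1 ≤ k) : IsClosed (Om S) := by
  refine isClosed_of_closure_subset fun z hz => ?_
  by_contra hzS
  have hle : ‖z‖ ≤ 1 := by
    simpa using closure_minimal (Om_subset_closedBall hS) isClosed_closedBall hz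
  have hge : ∀ n : ℕ, 1 - 1 / ((n : ℝ) + 1) ≤ ‖z‖ := by
    intro n
    have hclosed : IsClosed ((⋃ k ∈ S ∩ Set.Iic n, L k) ∪ {w : ℂ | 1 - 1 / ((n : ℝ) + 1) ≤ ‖w‖}) :=
      (((Set.finite_Iic n).inter_of_right S).isClosed_biUnion fun k _ => isClosed_L k).union
        (isClosed_le continuous_const continuous_norm)
    have hsub : Om S ⊆ (⋃ k ∈ S ∩ Set.Iic n, L k) ∪ {w : ℂ | 1 - 1 / ((n : ℝ) + 1) ≤ ‖w‖} := by
      rintro w (hw | hw)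
      · right
        have : 0 < 1 / ((n : ℝ) + 1) := by positivity
        rw [mem_sphere_zero_iff_norm] at hw
        simp only [Set.mem_ofPred_eq, hw]
        linarith
      · obtain ⟨k, hk, hwk⟩ := Set.mem_iUnion₂.1 hw
        by_cases hkn : k ≤ n
        · exact Or.inl (Set.mem_biUnion ⟨hk, hkn⟩ hwk)
        · right
          refine le_trans ?_ (norm_mem_Icc_of_mem_L (hS k hk) hwk).1
          have : (n : ℝ) + 1 ≤ k := by exact_mod_cast not_le.1 hkn
          gcongr
    rcases closure_minimal hsub hclosed hz with h | h
    · exact absurd (Or.inr (Set.biUnion_subset_biUnion_left Set.inter_subset_left h)) hzS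
    · exact h
  have hlim : Tendsto (fun n : ℕ => 1 - 1 / ((n : ℝ) + 1)) atTop (𝓝 (1 - 0)) :=
    tendsto_const_nhds.sub tendsto_one_div_add_atTop_nhds_zero_nat
  have hone : (1 : ℝ) ≤ ‖z‖ := by simpa using le_of_tendsto' hlim hge
  exact hzS (Or.inl (by simpa using le_antisymm hle hone))

lemma OmT_subset {A : Set ℕ} (hA : ∀ k ∈ A, 1 ≤ k) (t : ℝ) : OmT A t ⊆ Om {k : ℕ | 1 ≤ k} := by
  unfold OmT
  split_ifs
  · exact Om_mono hA
  · exact Om_mono fun k hk => hk.1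

lemma digit_eq_one {k : ℕ} (hk : 1 ≤ k) {t : ℝ} (ht : t ∈ Set.Ico (1 - 1 / (2 : ℝ) ^ k) 1) :
    digit k t = 1 := by
  have hpos : (0 : ℝ) < 2 ^ k := by positivity
  have hfloor : ⌊(2 : ℝ) ^ k * t⌋ = 2 ^ k - 1 := by
    rw [Int.floor_eq_iff]
    push_cast
    constructor
    · calc (2 : ℝ) ^ k - 1 = 2 ^ k * (1 - 1 / 2 ^ k) := by field_simp
        _ ≤ 2 ^ k * t := by gcongr; exact ht.1
    · nlinarith [ht.2]
  obtain ⟨m, rfl⟩ := Nat.exists_eq_add_of_le' hk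
  rw [digit, hfloor, pow_succ]
  omega

/-- The slice at `t = 1` of the closure `W` of `{(z,t) : t ∈ (0,1], z ∈ Ω_t}` is the union
of the unit circle with all the spokes `L_k`, `k ≥ 1`, independently of the set `A` used
to define `Ω_1`. -/
theorem slice_one_of_closure (A : Set ℕ) (hA : ∀ k ∈ A, 1 ≤ k) :
    {z : ℂ | (z, (1 : ℝ)) ∈
        closure {p : ℂ × ℝ | p.2 ∈ Set.Ioc (0 : ℝ) 1 ∧ p.1 ∈ OmT A p.2}} =
      Metric.sphere (0 : ℂ) 1 ∪ ⋃ k ∈ {k : ℕ | 1 ≤ k}, L k := by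
  refine Set.Subset.antisymm (fun z hz => ?_) ?_
  · have hclosed : IsClosed (Prod.fst ⁻¹' Om {k : ℕ | 1 ≤ k} : Set (ℂ × ℝ)) :=
      (isClosed_Om fun _ hk => hk).preimage continuous_fst
    have hsub : {p : ℂ × ℝ | p.2 ∈ Set.Ioc (0 : ℝ) 1 ∧ p.1 ∈ OmT A p.2} ⊆
        Prod.fst ⁻¹' Om {k : ℕ | 1 ≤ k} := fun p hp => OmT_subset hA p.2 hp.2
    exact closure_minimal hsub hclosed hz
  · rintro z (hz | hz)
    · refine subset_closure ⟨by simp, ?_⟩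
      simp only [OmT, if_true]
      exact Or.inl hz
    · obtain ⟨k, hk, hzk⟩ := Set.mem_iUnion₂.1 hz
      have hlim : Tendsto (fun t : ℝ => (z, t)) (𝓝[<] 1) (𝓝 (z, 1)) :=
        (Continuous.prodMk_right z).continuousAt.tendsto.mono_left nhdsWithin_le_nhds
      refine mem_closure_of_tendsto hlim ?_
      have hlt : 1 - 1 / (2 : ℝ) ^ k < 1 := sub_lt_self _ (by positivity)
      filter_upwards [Ioo_mem_nhdsLT hlt, Ioo_mem_nhdsLT zero_lt_one] with t ht ht0
      refine ⟨⟨ht0.1, ht0.2.le⟩, ?_⟩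
      simp only [OmT, if_neg ht.2.ne]
      exact Or.inr (Set.mem_biUnion ⟨hk, digit_eq_one hk ⟨ht.1.le, ht.2⟩⟩ hzk)
end
end
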